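/- arXiv:2201.03523 — 2 statements merged into one kernel-verified Lean document; each statement's English description precedes it below -/
import Mathlib

section
/- For all real numbers k and x with sin x ≠ 0, max(|sin(kx)/sin x|, |sin((k+1)x)/sin x|) ≥ 1/2. -/
/-- The sine of a difference is bounded by the sum of the absolute values of the sines. -/
theorem Real.abs_sin_sub_le (a b : ℝ) :
    |Real.sin (a - b)| ≤ |Real.sin a| + |Real.sin b| := by
  rw [Real.sin_sub]
  calc |Real.sin a * Real.cos b - Real.cos a * Real.sin b|
      ≤ |Real.sin a * Real.cos b| + |Real.cos a * Real.sin b| := abs_sub _ _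
    _ = |Real.sin a| * |Real.cos b| + |Real.cos a| * |Real.sin b| := by rw [abs_mul, abs_mul]
    _ ≤ |Real.sin a| + |Real.sin b| :=
      add_le_add (mul_le_of_le_one_right (abs_nonneg _) (Real.abs_cos_le_one b))
        (mul_le_of_le_one_left (abs_nonneg _) (Real.abs_cos_le_one a))

theorem max_sin_ratio_ge_half (k x : ℝ) (hx : Real.sin x ≠ 0) :
    max |Real.sin (k * x) / Real.sin x| |Real.sin ((k + 1) * x) / Real.sin x| ≥ 1 / 2 := by
  have hpos : 0 < |Real.sin x| := abs_pos.mpr hx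
  have h := Real.abs_sin_sub_le ((k + 1) * x) (k * x)
  rw [show (k + 1) * x - k * x = x by ring] at h
  rw [abs_div, abs_div, ge_iff_le, le_max_iff, le_div_iff₀ hpos, le_div_iff₀ hpos]
  by_contra! hlt
  linarith [hlt.1, hlt.2]
end

section
/- Let Ψ(X, y) denote the number of positive integers n ≤ X all of whose prime factors are at most y. Let y : ℝ → ℝ be a function with y(X) → ∞ and y(X)/log X → 0 as X → ∞. Then log Ψ(X, y(X)) = (1 + o(1)) · (y(X)/log y(X)) · log(log X / y(X)) as X → ∞; that is, the ratio of log Ψ(X, y(X)) to (y(X)/log y(X))·log(log X / y(X)) tends to 1. -/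
open Filter in
/-- `smoothCount X y` is Ψ(X, y), the number of positive integers `n ≤ X` all of whose
prime factors are at most `y`. -/
noncomputable def smoothCount (X y : ℝ) : ℕ :=
  Set.ncard {n : ℕ | 1 ≤ n ∧ (n : ℝ) ≤ X ∧ ∀ p : ℕ, p.Prime → p ∣ n → (p : ℝ) ≤ y}

open Filter MeasureTheory Set Topology

/-- The (unnormalised) Fejér kernel on the real line. -/
noncomputable def fejerKernel (x : ℝ) : ℝ := 2 * (1 - Real.cos x) / x ^ 2

lemma fejerKernel_nonneg (x : ℝ) : 0 ≤ fejerKernel x := by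
  have := Real.cos_le_one x
  unfold fejerKernel
  apply div_nonneg <;> nlinarith [sq_nonneg x]

lemma measurable_fejerKernel : Measurable fejerKernel := by
  unfold fejerKernel
  fun_prop

lemma fejerKernel_le (x : ℝ) : fejerKernel x ≤ 8 * (1 + x ^ 2)⁻¹ := by
  rcases eq_or_ne x 0 with rfl | hx
  · simp [fejerKernel]
  have hx2 : 0 < x ^ 2 := by positivity
  have h1 := Real.neg_one_le_cos x
  have h2 := Real.one_sub_sq_div_two_le_cos (x := x)
  unfold fejerKernel
  rw [← div_eq_mul_inv, div_le_div_iff₀ hx2 (by positivity)]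
  nlinarith

lemma integrable_fejerKernel : Integrable fejerKernel := by
  refine (integrable_inv_one_add_sq.const_mul 8).mono'
    measurable_fejerKernel.aestronglyMeasurable (ae_of_all _ fun x => ?_)
  rw [Real.norm_of_nonneg (fejerKernel_nonneg x)]
  exact fejerKernel_le x

lemma integral_fejerKernel_pos : 0 < ∫ x, fejerKernel x := by
  rw [integral_pos_iff_support_of_nonneg fejerKernel_nonneg integrable_fejerKernel]
  refine lt_of_lt_of_le ?_ (measure_mono (s := Ioo 0 1) fun x hx => ?_)
  · simp
  · have hx0 : 0 < x := hx.1
    have : Real.cos x < 1 := by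
      rw [← Real.cos_zero]
      exact Real.cos_lt_cos_of_nonneg_of_le_pi_div_two le_rfl
        (by linarith [Real.pi_gt_three, hx.2]) hx0
    simp only [Function.mem_support, fejerKernel]
    exact (div_pos (by linarith) (by positivity)).ne'

lemma integral_one_sub_mul_exp {z : ℂ} (hz : z ≠ 0) :
    ∫ t in (0 : ℝ)..1, ((1 - t : ℝ) : ℂ) * Complex.exp (t * z) = (Complex.exp z - 1 - z) / z ^ 2 := by
  have hd : ∀ t ∈ uIcc (0 : ℝ) 1, HasDerivAt
      (fun t : ℝ => (1 - (t : ℂ)) * Complex.exp (t * z) / z + Complex.exp (t * z) / z ^ 2)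
      (((1 - t : ℝ) : ℂ) * Complex.exp (t * z)) t := by
    intro t _
    have h0 : HasDerivAt (fun t : ℝ => (t : ℂ)) 1 t := Complex.ofRealCLM.hasDerivAt
    have he : HasDerivAt (fun t : ℝ => Complex.exp (t * z)) (Complex.exp (t * z) * z) t := by
      simpa using (h0.mul_const z).cexp
    refine ((((h0.const_sub 1).mul he).div_const z).add (he.div_const (z ^ 2))).congr_deriv ?_
    push_cast
    field_simp
    ring
  rw [intervalIntegral.integral_eq_sub_of_hasDerivAt hd
    (Continuous.intervalIntegrable (by fun_prop) _ _)]
  simp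
  field_simp
  ring

lemma integral_one_sub_abs_mul_exp {x : ℝ} (hx : x ≠ 0) :
    ∫ t in (-1 : ℝ)..1, ((1 - |t| : ℝ) : ℂ) * Complex.exp (t * (x * Complex.I)) =
      fejerKernel x := by
  have hc : Continuous fun t : ℝ => ((1 - |t| : ℝ) : ℂ) * Complex.exp (t * (x * Complex.I)) := by
    fun_prop
  have hxI : (x : ℂ) * Complex.I ≠ 0 := by simp [hx]
  rw [← intervalIntegral.integral_add_adjacent_intervals (b := 0)
    (hc.intervalIntegrable _ _) (hc.intervalIntegrable _ _)]
  have h1 : ∫ t in (-1 : ℝ)..0, ((1 - |t| : ℝ) : ℂ) * Complex.exp (t * (x * Complex.I)) =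
      ∫ t in (0 : ℝ)..1, ((1 - t : ℝ) : ℂ) * Complex.exp (t * (-(x * Complex.I))) := by
    have h := intervalIntegral.integral_comp_neg (a := 0) (b := 1)
      fun t : ℝ => ((1 - |t| : ℝ) : ℂ) * Complex.exp (t * (x * Complex.I))
    rw [neg_zero] at h
    rw [← h]
    refine intervalIntegral.integral_congr fun t ht => ?_
    rw [uIcc_of_le (by norm_num)] at ht
    simp [abs_of_nonneg ht.1]
  have h2 : ∫ t in (0 : ℝ)..1, ((1 - |t| : ℝ) : ℂ) * Complex.exp (t * (x * Complex.I)) =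
      ∫ t in (0 : ℝ)..1, ((1 - t : ℝ) : ℂ) * Complex.exp (t * (x * Complex.I)) := by
    refine intervalIntegral.integral_congr fun t ht => ?_
    rw [uIcc_of_le (by norm_num)] at ht
    simp [abs_of_nonneg ht.1]
  rw [h1, h2, integral_one_sub_mul_exp hxI, integral_one_sub_mul_exp (neg_ne_zero.2 hxI)]
  have hcos : Complex.exp (x * Complex.I) + Complex.exp (-(x * Complex.I)) = 2 * Complex.cos x := by
    rw [Complex.cos]; ring_nf
  have hx' : (x : ℂ) ≠ 0 := by exact_mod_cast hx
  unfold fejerKernel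
  push_cast
  rw [neg_sq, ← add_div, mul_pow, Complex.I_sq]
  field_simp
  linear_combination -hcos

section Tauberian

variable {b : ℝ → ℝ} {M : ℝ} {H : ℂ → ℂ}

lemma integral_mul_exp_mul_fejerKernel (hb : Measurable b) (hM : ∀ u, |b u| ≤ M)
    (hlap : ∀ s : ℂ, 0 < s.re → ∫ u in Ioi (0 : ℝ), (b u : ℂ) * Complex.exp (-s * u) = H s)
    {l : ℝ} (hl : 0 < l) (v : ℝ) {δ : ℝ} (hδ : 0 < δ) :
    ∫ u in Ioi (0 : ℝ), ((b u * Real.exp (-δ * u) * fejerKernel (l * (v - u)) : ℝ) : ℂ) =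
      ∫ t in (-1 : ℝ)..1, ((1 - |t| : ℝ) : ℂ) * Complex.exp (t * (l * v * Complex.I)) *
        H (δ + l * t * Complex.I) := by
  have hM0 : 0 ≤ M := (abs_nonneg _).trans (hM 0)
  let F : ℝ → ℝ → ℂ := fun u t => (b u : ℂ) * Complex.exp (-(δ : ℂ) * u) *
    (((1 - |t| : ℝ) : ℂ) * Complex.exp (t * ((l * (v - u) : ℝ) * Complex.I)))
  have hF_int : Integrable (Function.uncurry F)
      ((volume.restrict (Ioi (0 : ℝ))).prod (volume.restrict (Ioc (-1 : ℝ) 1))) := by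
    have h1 : Integrable (fun u : ℝ => M * Real.exp (-δ * u)) (volume.restrict (Ioi (0 : ℝ))) :=
      (integrableOn_exp_mul_Ioi (by linarith) 0).const_mul M
    have h2 : Integrable (fun t : ℝ => 1 - |t|) (volume.restrict (Ioc (-1 : ℝ) 1)) :=
      (Continuous.integrableOn_Ioc (by fun_prop))
    refine (h1.mul_prod h2.norm).mono' ?_ (ae_of_all _ fun p => ?_)
    · refine Measurable.aestronglyMeasurable ?_
      simp only [F, Function.uncurry_def]
      fun_prop
    · simp only [F, Function.uncurry_def, norm_mul, Complex.norm_real, Complex.norm_exp]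
      have : Real.exp ((p.2 : ℂ) * (((l * (v - p.1) : ℝ) : ℂ) * Complex.I)).re = 1 := by
        simp
      rw [this, mul_one]
      refine mul_le_mul_of_nonneg_right ?_ (norm_nonneg _)
      have h3 : (-(δ : ℂ) * (p.1 : ℂ)).re = -δ * p.1 := by simp
      rw [h3]
      exact mul_le_mul_of_nonneg_right (hM _) (Real.exp_nonneg _)
  have hL : ∀ᵐ u ∂(volume.restrict (Ioi (0 : ℝ))),
      ((b u * Real.exp (-δ * u) * fejerKernel (l * (v - u)) : ℝ) : ℂ) =
        ∫ t in Ioc (-1 : ℝ) 1, F u t := by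
    have hne : ∀ᵐ u ∂(volume.restrict (Ioi (0 : ℝ))), u ≠ v :=
      ae_restrict_of_ae (by simp [ae_iff])
    filter_upwards [hne] with u hu
    simp only [F]
    rw [integral_const_mul, ← intervalIntegral.integral_of_le (by norm_num),
      integral_one_sub_abs_mul_exp (mul_ne_zero hl.ne' (sub_ne_zero.2 hu.symm))]
    push_cast
    ring
  rw [integral_congr_ae hL, integral_integral_swap hF_int,
    intervalIntegral.integral_of_le (by norm_num)]
  refine integral_congr_ae (ae_of_all _ fun t => ?_)
  simp only
  rw [← hlap (δ + l * t * Complex.I) (by simpa using hδ), ← integral_const_mul]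
  refine integral_congr_ae (ae_of_all _ fun u => ?_)
  simp only [F]
  have : Complex.exp (-(δ : ℂ) * u) * Complex.exp (t * ((l * (v - u) : ℝ) * Complex.I)) =
      Complex.exp (t * (l * v * Complex.I)) * Complex.exp (-(δ + l * t * Complex.I) * u) := by
    rw [← Complex.exp_add, ← Complex.exp_add]
    push_cast
    ring_nf
  linear_combination ((b u : ℂ) * ((1 - |t| : ℝ) : ℂ)) * this

lemma integrable_fejerKernel_comp {l : ℝ} (hl : 0 < l) (v : ℝ) :
    Integrable fun u => fejerKernel (l * (v - u)) :=
  (integrable_fejerKernel.comp_mul_left' hl.ne').comp_sub_left v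

lemma integral_mul_fejerKernel (hb : Measurable b) (hM : ∀ u, |b u| ≤ M)
    (hlap : ∀ s : ℂ, 0 < s.re → ∫ u in Ioi (0 : ℝ), (b u : ℂ) * Complex.exp (-s * u) = H s)
    (hH : ContinuousOn H {s | 0 ≤ s.re}) {l : ℝ} (hl : 0 < l) (v : ℝ) :
    ∫ u in Ioi (0 : ℝ), ((b u * fejerKernel (l * (v - u)) : ℝ) : ℂ) =
      ∫ t in (-1 : ℝ)..1, ((1 - |t| : ℝ) : ℂ) * Complex.exp (t * (l * v * Complex.I)) *
        H (l * t * Complex.I) := by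
  have hM0 : 0 ≤ M := (abs_nonneg _).trans (hM 0)
  have hL : Tendsto (fun δ : ℝ => ∫ u in Ioi (0 : ℝ),
      ((b u * Real.exp (-δ * u) * fejerKernel (l * (v - u)) : ℝ) : ℂ)) (𝓝[>] 0)
      (𝓝 (∫ u in Ioi (0 : ℝ), ((b u * fejerKernel (l * (v - u)) : ℝ) : ℂ))) := by
    refine tendsto_integral_filter_of_dominated_convergence
      (fun u => M * fejerKernel (l * (v - u))) ?_ ?_
      ((integrable_fejerKernel_comp hl v).const_mul M).integrableOn ?_
    · refine Eventually.of_forall fun δ => Measurable.aestronglyMeasurable ?_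
      have := measurable_fejerKernel
      fun_prop
    · filter_upwards [self_mem_nhdsWithin] with δ hδ
      filter_upwards [ae_restrict_mem measurableSet_Ioi] with u hu
      rw [Complex.norm_real, norm_mul, norm_mul, Real.norm_of_nonneg (fejerKernel_nonneg _),
        Real.norm_of_nonneg (Real.exp_nonneg _)]
      refine mul_le_mul_of_nonneg_right ?_ (fejerKernel_nonneg _)
      have : Real.exp (-δ * u) ≤ 1 := by
        rw [Real.exp_le_one_iff]
        have := mul_pos (mem_Ioi.1 hδ) (mem_Ioi.1 hu)
        linarith
      calc ‖b u‖ * Real.exp (-δ * u) ≤ M * 1 := by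
            gcongr
            exact hM u
        _ = M := mul_one M
    · refine ae_of_all _ fun u => ?_
      have : Continuous fun δ : ℝ =>
          ((b u * Real.exp (-δ * u) * fejerKernel (l * (v - u)) : ℝ) : ℂ) := by fun_prop
      simpa using (this.tendsto 0).mono_left nhdsWithin_le_nhds
  have hcomp : IsCompact (Icc (0 : ℝ) 1 ×ˢ Icc (-1 : ℝ) 1) := isCompact_Icc.prod isCompact_Icc
  have hcont : ContinuousOn (fun p : ℝ × ℝ => H (p.1 + l * p.2 * Complex.I))
      (Ici (0 : ℝ) ×ˢ univ) := by
    refine hH.comp (by fun_prop) fun p hp => ?_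
    simpa using hp.1
  obtain ⟨C, hC⟩ := hcomp.exists_bound_of_continuousOn
    (hcont.mono (prod_mono Icc_subset_Ici_self (subset_univ _)))
  have hR : Tendsto (fun δ : ℝ => ∫ t in (-1 : ℝ)..1, ((1 - |t| : ℝ) : ℂ) *
      Complex.exp (t * (l * v * Complex.I)) * H (δ + l * t * Complex.I)) (𝓝[>] 0)
      (𝓝 (∫ t in (-1 : ℝ)..1, ((1 - |t| : ℝ) : ℂ) * Complex.exp (t * (l * v * Complex.I)) *
        H (l * t * Complex.I))) := by
    refine intervalIntegral.tendsto_integral_filter_of_dominated_convergence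
      (fun _ => C) ?_ ?_ (by simp) ?_
    · filter_upwards [self_mem_nhdsWithin] with δ hδ
      refine Continuous.aestronglyMeasurable ?_
      refine Continuous.mul (by fun_prop) ?_
      refine hcont.comp_continuous (f := fun t : ℝ => (δ, t)) (by fun_prop) fun t => ?_
      exact ⟨(mem_Ioi.1 hδ).le, mem_univ _⟩
    · filter_upwards [Ioc_mem_nhdsGT (zero_lt_one' ℝ)] with δ hδ
      refine ae_of_all _ fun t ht => ?_
      rw [uIoc_of_le (by norm_num)] at ht
      have h1 := hC (δ, t) ⟨⟨hδ.1.le, hδ.2⟩, ⟨ht.1.le, ht.2⟩⟩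
      have h2 : ‖Complex.exp (t * (l * v * Complex.I))‖ = 1 := by
        simp [Complex.norm_exp]
      rw [norm_mul, norm_mul, h2, mul_one, Complex.norm_real]
      have h3 : |t| ≤ 1 := abs_le.2 ⟨ht.1.le, ht.2⟩
      have h4 : ‖1 - |t|‖ ≤ 1 := by
        rw [Real.norm_of_nonneg (by linarith)]
        linarith [abs_nonneg t]
      calc _ ≤ 1 * C := mul_le_mul h4 h1 (norm_nonneg _) zero_le_one
        _ = C := one_mul C
    · refine ae_of_all _ fun t _ => Tendsto.const_mul _ ?_
      have h0 : Tendsto (fun δ : ℝ => (δ, t)) (𝓝[>] 0) (𝓝[Ici (0 : ℝ) ×ˢ univ] (0, t)) := by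
        refine tendsto_nhdsWithin_iff.2 ⟨?_, ?_⟩
        · exact (Continuous.tendsto (by fun_prop) (0 : ℝ)).mono_left nhdsWithin_le_nhds
        · filter_upwards [self_mem_nhdsWithin] with δ hδ
          exact ⟨(mem_Ioi.1 hδ).le, mem_univ _⟩
      simpa [Function.comp_def] using (hcont (0, t) ⟨self_mem_Ici, mem_univ _⟩).tendsto.comp h0
  refine tendsto_nhds_unique hL (hR.congr' ?_)
  filter_upwards [self_mem_nhdsWithin] with δ hδ
  exact (integral_mul_exp_mul_fejerKernel hb hM hlap hl v hδ).symm

/-- If the Laplace transform of a bounded function extends continuously to the closed half-plane,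
then its convolution with every rescaled Fejér kernel vanishes at infinity. -/
lemma tendsto_integral_mul_fejerKernel (hb : Measurable b) (hM : ∀ u, |b u| ≤ M)
    (hlap : ∀ s : ℂ, 0 < s.re → ∫ u in Ioi (0 : ℝ), (b u : ℂ) * Complex.exp (-s * u) = H s)
    (hH : ContinuousOn H {s | 0 ≤ s.re}) {l : ℝ} (hl : 0 < l) :
    Tendsto (fun v => ∫ u in Ioi (0 : ℝ), b u * fejerKernel (l * (v - u))) atTop (𝓝 0) := by
  have hRL := Real.tendsto_integral_exp_smul_cocompact
    ((Ioc (-1 : ℝ) 1).indicator fun t : ℝ => ((1 - |t| : ℝ) : ℂ) * H (l * t * Complex.I))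
  have hw : Tendsto (fun v : ℝ => -(l / (2 * Real.pi)) * v) atTop (cocompact ℝ) :=
    (tendsto_id.const_mul_atTop_of_neg (by
      have := Real.pi_pos
      have : 0 < l / (2 * Real.pi) := by positivity
      linarith)).mono_right atBot_le_cocompact
  have h := hRL.comp hw
  rw [← tendsto_ofReal_iff, Complex.ofReal_zero]
  refine h.congr fun v => ?_
  rw [← integral_complex_ofReal, integral_mul_fejerKernel hb hM hlap hH hl v,
    intervalIntegral.integral_of_le (by norm_num), ← integral_indicator measurableSet_Ioc]
  refine integral_congr_ae (ae_of_all _ fun t => ?_)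
  by_cases ht : t ∈ Ioc (-1 : ℝ) 1
  · simp only [indicator_of_mem ht, Circle.smul_def, Real.fourierChar_apply, smul_eq_mul]
    have : ((2 * Real.pi * -(t * (-(l / (2 * Real.pi)) * v)) : ℝ) : ℂ) * Complex.I =
        t * (l * v * Complex.I) := by
      have : (Real.pi : ℂ) ≠ 0 := by exact_mod_cast Real.pi_ne_zero
      push_cast
      field_simp
    rw [this]
    ring
  · simp [indicator_of_notMem ht]

lemma setIntegral_comp_sub_left (g : ℝ → ℝ) (v : ℝ) (s : Set ℝ) :
    ∫ u in (fun u => v - u) ⁻¹' s, g (v - u) = ∫ x in s, g x :=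
  (Measure.measurePreserving_sub_left volume v).setIntegral_preimage_emb
    (MeasurableEquiv.subLeft v).measurableEmbedding g s

lemma tendsto_integral_Ioi_comp_sub_left {g : ℝ → ℝ} (hg : Integrable g) :
    Tendsto (fun v => ∫ u in Ioi (0 : ℝ), g (v - u)) atTop (𝓝 (∫ x, g x)) := by
  have h := (aecover_Iio tendsto_id).integral_tendsto_of_countably_generated hg
  refine h.congr fun v => ?_
  rw [← setIntegral_comp_sub_left g v]
  congr 2
  ext u
  simp

variable {B : ℝ → ℝ}

lemma mul_exp_le_integral_mul_fejerKernel (hB : Measurable B) (h0 : ∀ u, 0 ≤ B u)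
    (hM : ∀ u, B u ≤ M) (hmono : ∀ u w, u ≤ w → B u * Real.exp u ≤ B w * Real.exp w)
    {l η v : ℝ} (hl : 0 < l) (hv : η < v) :
    B (v - η) * Real.exp (-(2 * η)) * ∫ x in Icc (-η) η, fejerKernel (l * x) ≤
      ∫ u in Ioi (0 : ℝ), B u * fejerKernel (l * (v - u)) := by
  have hset : (fun u => v - u) ⁻¹' Icc (-η) η = Icc (v - η) (v + η) := by
    ext u
    simp only [mem_preimage, mem_Icc]
    constructor <;> rintro ⟨h1, h2⟩ <;> constructor <;> linarith
  have hi : Integrable fun u => B u * fejerKernel (l * (v - u)) :=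
    (integrable_fejerKernel_comp hl v).bdd_mul hB.aestronglyMeasurable
      (ae_of_all _ fun u => by rw [Real.norm_of_nonneg (h0 u)]; exact hM u)
  rw [← setIntegral_comp_sub_left (fun x => fejerKernel (l * x)) v, hset, ← integral_const_mul]
  calc _ ≤ ∫ u in Icc (v - η) (v + η), B u * fejerKernel (l * (v - u)) := by
        refine setIntegral_mono_on ((integrable_fejerKernel_comp hl v).const_mul _).integrableOn
          hi.integrableOn measurableSet_Icc fun u hu => ?_
        refine mul_le_mul_of_nonneg_right ?_ (fejerKernel_nonneg _)
        have h1 := hmono _ _ hu.1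
        have h2 : Real.exp (v - η) = Real.exp (v - η - u) * Real.exp u := by
          rw [← Real.exp_add]; ring_nf
        rw [h2, ← mul_assoc] at h1
        refine le_trans ?_ (le_of_mul_le_mul_right h1 (Real.exp_pos u))
        refine mul_le_mul_of_nonneg_left (Real.exp_le_exp.2 ?_) (h0 _)
        linarith [hu.2]
    _ ≤ _ := by
        refine setIntegral_mono_set hi.integrableOn
          (ae_of_all _ fun u => mul_nonneg (h0 u) (fejerKernel_nonneg _))
          (LE.le.eventuallyLE fun u hu => ?_)
        exact mem_Ioi.2 (by linarith [hu.1])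

lemma integral_mul_fejerKernel_le (hB : Measurable B) (h0 : ∀ u, 0 ≤ B u)
    (hM : ∀ u, B u ≤ M) (hmono : ∀ u w, u ≤ w → B u * Real.exp u ≤ B w * Real.exp w)
    {l η v : ℝ} (hl : 0 < l) :
    ∫ u in Ioi (0 : ℝ), B u * fejerKernel (l * (v - u)) ≤
      B (v + η) * Real.exp (2 * η) * (∫ x, fejerKernel (l * x)) +
        M * ((∫ x, fejerKernel (l * x)) - ∫ x in Icc (-η) η, fejerKernel (l * x)) := by
  have hset : (fun u => v - u) ⁻¹' Icc (-η) η = Icc (v - η) (v + η) := by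
    ext u
    simp only [mem_preimage, mem_Icc]
    constructor <;> rintro ⟨h1, h2⟩ <;> constructor <;> linarith
  have hk := integrable_fejerKernel_comp hl v
  have hM0 : 0 ≤ M := (h0 0).trans (hM 0)
  have hi : Integrable fun u => B u * fejerKernel (l * (v - u)) :=
    hk.bdd_mul hB.aestronglyMeasurable
      (ae_of_all _ fun u => by rw [Real.norm_of_nonneg (h0 u)]; exact hM u)
  have hI : ∫ u, fejerKernel (l * (v - u)) = ∫ x, fejerKernel (l * x) :=
    integral_sub_left_eq_self (fun x => fejerKernel (l * x)) volume v
  rw [← setIntegral_comp_sub_left (fun x => fejerKernel (l * x)) v, hset, ← hI]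
  have hc : (∫ u, fejerKernel (l * (v - u))) - ∫ u in Icc (v - η) (v + η),
      fejerKernel (l * (v - u)) = ∫ u in (Icc (v - η) (v + η))ᶜ, fejerKernel (l * (v - u)) := by
    rw [← integral_add_compl measurableSet_Icc hk]
    ring
  rw [hc]
  calc _ ≤ ∫ u, B u * fejerKernel (l * (v - u)) :=
        setIntegral_le_integral hi (ae_of_all _ fun u => mul_nonneg (h0 u) (fejerKernel_nonneg _))
    _ = (∫ u in Icc (v - η) (v + η), B u * fejerKernel (l * (v - u))) +
        ∫ u in (Icc (v - η) (v + η))ᶜ, B u * fejerKernel (l * (v - u)) :=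
        (integral_add_compl measurableSet_Icc hi).symm
    _ ≤ _ := by
      refine add_le_add ?_ ?_
      · calc _ ≤ ∫ u in Icc (v - η) (v + η),
              B (v + η) * Real.exp (2 * η) * fejerKernel (l * (v - u)) := by
              refine setIntegral_mono_on hi.integrableOn (hk.const_mul _).integrableOn
                measurableSet_Icc fun u hu => ?_
              refine mul_le_mul_of_nonneg_right ?_ (fejerKernel_nonneg _)
              have h1 := hmono _ _ hu.2
              have h2 : Real.exp (v + η) = Real.exp (v + η - u) * Real.exp u := by
                rw [← Real.exp_add]; ring_nf
              rw [h2, ← mul_assoc] at h1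
              refine (le_of_mul_le_mul_right h1 (Real.exp_pos u)).trans ?_
              refine mul_le_mul_of_nonneg_left (Real.exp_le_exp.2 ?_) (h0 _)
              linarith [hu.1]
          _ ≤ ∫ u, B (v + η) * Real.exp (2 * η) * fejerKernel (l * (v - u)) :=
              setIntegral_le_integral (hk.const_mul _) (ae_of_all _ fun u =>
                mul_nonneg (mul_nonneg (h0 _) (Real.exp_nonneg _)) (fejerKernel_nonneg _))
          _ = _ := integral_const_mul _ _
      · rw [← integral_const_mul]
        exact setIntegral_mono_on hi.integrableOn (hk.const_mul _).integrableOn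
          measurableSet_Icc.compl fun u _ =>
            mul_le_mul_of_nonneg_right (hM u) (fejerKernel_nonneg _)

lemma exists_fejerKernel_concentrated {η ε : ℝ} (hη : 0 < η) (hε : 0 < ε) :
    ∃ l : ℝ, 0 < l ∧ 0 < ∫ x, fejerKernel (l * x) ∧
      (1 - ε) * ∫ x, fejerKernel (l * x) ≤ ∫ x in Icc (-η) η, fejerKernel (l * x) := by
  have ht : Tendsto (fun l : ℝ => ∫ x in (-(l * η))..(l * η), fejerKernel x) atTop
      (𝓝 (∫ x, fejerKernel x)) :=
    intervalIntegral_tendsto_integral integrable_fejerKernel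
      (tendsto_neg_atTop_atBot.comp (tendsto_id.atTop_mul_const hη))
      (tendsto_id.atTop_mul_const hη)
  have hpos := integral_fejerKernel_pos
  obtain ⟨l, hl, hl0⟩ := ((ht.eventually_const_lt
    (show (1 - ε) * ∫ x, fejerKernel x < ∫ x, fejerKernel x by nlinarith)).and
      (eventually_gt_atTop 0)).exists
  have h1 : ∫ x, fejerKernel (l * x) = l⁻¹ * ∫ x, fejerKernel x := by
    rw [Measure.integral_comp_mul_left, abs_of_pos (inv_pos.2 hl0), smul_eq_mul]
  refine ⟨l, hl0, by rw [h1]; positivity, ?_⟩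
  rw [h1, integral_Icc_eq_integral_Ioc, ← intervalIntegral.integral_of_le (by linarith),
    intervalIntegral.integral_comp_mul_left _ hl0.ne', smul_eq_mul, mul_neg]
  calc _ = l⁻¹ * ((1 - ε) * ∫ x, fejerKernel x) := by ring
    _ ≤ _ := by gcongr

/-- The Wiener–Ikehara theorem for bounded functions `B` such that `B u * exp u` is monotone. -/
theorem tendsto_one_of_laplace_extends (hB : Measurable B) (h0 : ∀ u, 0 ≤ B u)
    (hM : ∀ u, B u ≤ M) (hmono : ∀ u w, u ≤ w → B u * Real.exp u ≤ B w * Real.exp w)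
    (hlap : ∀ s : ℂ, 0 < s.re →
      ∫ u in Ioi (0 : ℝ), ((B u - 1 : ℝ) : ℂ) * Complex.exp (-s * u) = H s)
    (hH : ContinuousOn H {s | 0 ≤ s.re}) :
    Tendsto B atTop (𝓝 1) := by
  have hM0 : 0 ≤ M := (h0 0).trans (hM 0)
  have hconv : ∀ l : ℝ, 0 < l →
      Tendsto (fun v => ∫ u in Ioi (0 : ℝ), B u * fejerKernel (l * (v - u))) atTop
        (𝓝 (∫ x, fejerKernel (l * x))) := by
    intro l hl
    have h1 := tendsto_integral_mul_fejerKernel (hB.sub_const 1) (M := M + 1)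
      (fun u => abs_le.2 ⟨by linarith [h0 u], by linarith [hM u]⟩) hlap hH hl
    have h2 := tendsto_integral_Ioi_comp_sub_left
      (integrable_fejerKernel.comp_mul_left' hl.ne')
    have h3 := h1.add h2
    rw [zero_add] at h3
    refine h3.congr fun v => ?_
    have hk := integrable_fejerKernel_comp hl v
    have hi : Integrable fun u => B u * fejerKernel (l * (v - u)) :=
      hk.bdd_mul hB.aestronglyMeasurable
        (ae_of_all _ fun u => by rw [Real.norm_of_nonneg (h0 u)]; exact hM u)
    have hi' : Integrable fun u => (B u - 1) * fejerKernel (l * (v - u)) := by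
      refine (hi.sub hk).congr (ae_of_all _ fun u => ?_)
      simp only [Pi.sub_apply]
      ring
    rw [← integral_add hi'.integrableOn hk.integrableOn]
    congr 1 with u
    ring
  have key : ∀ ε : ℝ, 0 < ε → ε < 1 → ∀ᶠ v in atTop,
      (1 - ε - M * ε) / (1 + ε) ≤ B v ∧ B v ≤ (1 + ε) ^ 2 / (1 - ε) := by
    intro ε hε hε1
    have hη : 0 < Real.log (1 + ε) / 2 := by
      have := Real.log_pos (show 1 < 1 + ε by linarith)
      positivity
    set η := Real.log (1 + ε) / 2 with hηdef
    have he : Real.exp (2 * η) = 1 + ε := by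
      rw [hηdef, mul_div_cancel₀ _ two_ne_zero, Real.exp_log (by linarith)]
    obtain ⟨l, hl, hI, hP⟩ := exists_fejerKernel_concentrated hη hε
    set I := ∫ x, fejerKernel (l * x)
    set P := ∫ x in Icc (-η) η, fejerKernel (l * x)
    have hlo := (hconv l hl).eventually_const_le (show (1 - ε) * I < I by nlinarith)
    have hhi := (hconv l hl).eventually_le_const (show I < (1 + ε) * I by nlinarith)
    have hs1 : Tendsto (fun v : ℝ => v - η) atTop atTop := tendsto_atTop_add_const_right _ _ tendsto_id
    have hs2 : Tendsto (fun v : ℝ => v + η) atTop atTop := tendsto_atTop_add_const_right _ _ tendsto_id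
    filter_upwards [hs1.eventually hlo, hs2.eventually hhi, eventually_gt_atTop 0] with v h1 h2 hv
    constructor
    · have h3 := h1.trans (integral_mul_fejerKernel_le (v := v - η) (η := η) hB h0 hM hmono hl)
      rw [sub_add_cancel, he] at h3
      rw [div_le_iff₀ (by linarith)]
      have h4 : M * (I - P) ≤ M * (ε * I) := mul_le_mul_of_nonneg_left (by linarith) hM0
      have h5 : (1 - ε - M * ε) * I ≤ B v * (1 + ε) * I := by
        have : (1 - ε) * I ≤ B v * (1 + ε) * I + M * (I - P) := h3
        linarith
      exact le_of_mul_le_mul_right h5 hI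
    · have h3 := (mul_exp_le_integral_mul_fejerKernel (v := v + η) (η := η) hB h0 hM hmono hl
        (by linarith)).trans h2
      rw [add_sub_cancel_right, Real.exp_neg, he] at h3
      rw [le_div_iff₀ (by linarith)]
      have h4 : B v * (1 + ε)⁻¹ * ((1 - ε) * I) ≤ (1 + ε) * I :=
        (mul_le_mul_of_nonneg_left hP
          (mul_nonneg (h0 v) (inv_nonneg.2 (by linarith)))).trans h3
      have h5 : (B v * (1 - ε)) * I ≤ (1 + ε) ^ 2 * I := by
        calc (B v * (1 - ε)) * I = (1 + ε) * (B v * (1 + ε)⁻¹ * ((1 - ε) * I)) := by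
              field_simp
          _ ≤ (1 + ε) * ((1 + ε) * I) := mul_le_mul_of_nonneg_left h4 (by linarith)
          _ = _ := by ring
      exact le_of_mul_le_mul_right h5 hI
  have hlim1 : Tendsto (fun ε : ℝ => (1 - ε - M * ε) / (1 + ε)) (𝓝[>] 0) (𝓝 1) := by
    have : ContinuousAt (fun ε : ℝ => (1 - ε - M * ε) / (1 + ε)) 0 := by
      refine ContinuousAt.div (by fun_prop) (by fun_prop) (by norm_num)
    simpa using this.tendsto.mono_left nhdsWithin_le_nhds
  have hlim2 : Tendsto (fun ε : ℝ => (1 + ε) ^ 2 / (1 - ε)) (𝓝[>] 0) (𝓝 1) := by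
    have : ContinuousAt (fun ε : ℝ => (1 + ε) ^ 2 / (1 - ε)) 0 := by
      refine ContinuousAt.div (by fun_prop) (by fun_prop) (by norm_num)
    simpa using this.tendsto.mono_left nhdsWithin_le_nhds
  have hsmall : ∀ᶠ ε : ℝ in 𝓝[>] 0, 0 < ε ∧ ε < 1 := Ioo_mem_nhdsGT one_pos
  refine tendsto_order.2 ⟨fun a ha => ?_, fun a ha => ?_⟩
  · obtain ⟨ε, h1, h2, h3⟩ := ((hlim1.eventually_const_lt ha).and hsmall).exists
    filter_upwards [key ε h2 h3] with v hv using h1.trans_le hv.1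
  · obtain ⟨ε, h1, h2, h3⟩ := ((hlim2.eventually_lt_const ha).and hsmall).exists
    filter_upwards [key ε h2 h3] with v hv using hv.2.trans_lt h1

end Tauberian

section PrimeNumberTheorem

open ArithmeticFunction Chebyshev

/-- The continuous extension to `0 ≤ re s` of the Laplace transform of `ψ(exp u) exp(-u) - 1`. -/
noncomputable def psiLaplace (s : ℂ) : ℂ :=
  (vonMangoldt.LFunctionResidueClassAux (1 : ZMod 1) (s + 1) - 1) / (s + 1)

lemma continuousOn_psiLaplace : ContinuousOn psiLaplace {s | 0 ≤ s.re} := by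
  have hne : ∀ s ∈ {s : ℂ | 0 ≤ s.re}, s + 1 ≠ 0 := by
    intro s hs h
    have := congrArg Complex.re h
    simp only [Complex.add_re, Complex.one_re, Complex.zero_re] at this
    have hs' : 0 ≤ s.re := hs
    linarith
  refine ContinuousOn.div (ContinuousOn.sub ?_ continuousOn_const) (by fun_prop) hne
  refine (vonMangoldt.continuousOn_LFunctionResidueClassAux (1 : ZMod 1)).comp (by fun_prop) ?_
  intro s hs
  have hs' : 0 ≤ s.re := hs
  simpa using hs'

lemma LSeries_vonMangoldt_eq_aux {s : ℂ} (hs : 0 < s.re) :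
    LSeries (fun n => (Λ n : ℂ)) (s + 1) =
      vonMangoldt.LFunctionResidueClassAux (1 : ZMod 1) (s + 1) + 1 / s := by
  have h := vonMangoldt.eqOn_LFunctionResidueClassAux (a := (1 : ZMod 1)) isUnit_one
    (show s + 1 ∈ {s : ℂ | 1 < s.re} by simpa using hs)
  have hres : (fun n => (vonMangoldt.residueClass (1 : ZMod 1) n : ℂ)) = fun n => (Λ n : ℂ) := by
    ext n
    simp [vonMangoldt.residueClass, Set.indicator, Subsingleton.elim (n : ZMod 1) 1]
  rw [h]
  simp only [hres]
  simp

lemma LSeries_vonMangoldt_eq_integral {s : ℂ} (hs : 0 < s.re) :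
    LSeries (fun n => (Λ n : ℂ)) (s + 1) = (s + 1) *
      ∫ u in Ioi (0 : ℝ), ((ψ (Real.exp u) * Real.exp (-u) : ℝ) : ℂ) * Complex.exp (-s * u) := by
  have hO : (fun n : ℕ => ∑ k ∈ Finset.Icc 1 n, Λ k) =O[atTop] fun n => (n : ℝ) ^ (1 : ℝ) := by
    refine Asymptotics.IsBigO.of_bound (Real.log 4 + 4) (Eventually.of_forall fun n => ?_)
    have h1 := psi_le_const_mul_self (x := n) (Nat.cast_nonneg n)
    have h2 := psi_nonneg n
    have h3 : ∑ k ∈ Finset.Icc 1 n, Λ k = ψ n := by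
      simp [psi, Finset.Icc_add_one_left_eq_Ioc 0 n |>.symm]
    rw [h3, Real.norm_of_nonneg h2, Real.rpow_one, Real.norm_of_nonneg (Nat.cast_nonneg n)]
    exact h1
  rw [LSeries_eq_mul_integral_of_nonneg (fun n => Λ n) zero_le_one (by simpa using hs) hO
    fun n => vonMangoldt_nonneg]
  congr 1
  have himg : Real.exp '' Ioi 0 = Ioi 1 := by
    ext x
    constructor
    · rintro ⟨u, hu, rfl⟩
      exact Real.one_lt_exp_iff.2 hu
    · intro hx
      have hx' : (1 : ℝ) < x := hx
      exact ⟨Real.log x, Real.log_pos hx', Real.exp_log (by linarith)⟩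
  rw [← himg, integral_image_eq_integral_abs_deriv_smul measurableSet_Ioi
    (fun x _ => (Real.hasDerivAt_exp x).hasDerivWithinAt) Real.exp_injective.injOn]
  refine integral_congr_ae (ae_of_all _ fun u => ?_)
  have h3 : ∑ k ∈ Finset.Icc 1 ⌊Real.exp u⌋₊, (Λ k : ℂ) = (ψ (Real.exp u) : ℂ) := by
    simp [psi, Finset.Icc_add_one_left_eq_Ioc 0 _ |>.symm]
  have h4 : ((Real.exp u : ℝ) : ℂ) ^ (-(s + 1 + 1)) = Complex.exp (-(s + 1 + 1) * u) := by
    rw [Complex.cpow_def_of_ne_zero (by exact_mod_cast (Real.exp_pos u).ne'),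
      ← Complex.ofReal_log (Real.exp_nonneg u), Real.log_exp, mul_comm]
  have h5 : Complex.exp u * Complex.exp (-(s + 1 + 1) * u) =
      Complex.exp (-u) * Complex.exp (-s * u) := by
    rw [← Complex.exp_add, ← Complex.exp_add]
    ring_nf
  simp only [h3, h4, abs_of_pos (Real.exp_pos u), Complex.real_smul]
  push_cast
  linear_combination (ψ (Real.exp u) : ℂ) * h5

lemma psi_exp_mul_exp_neg_le (u : ℝ) : ψ (Real.exp u) * Real.exp (-u) ≤ Real.log 4 + 4 := by
  rw [Real.exp_neg, ← div_eq_mul_inv, div_le_iff₀ (Real.exp_pos u)]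
  exact psi_le_const_mul_self (Real.exp_nonneg u)

lemma measurable_psi_exp_mul_exp_neg :
    Measurable fun u : ℝ => ψ (Real.exp u) * Real.exp (-u) := by
  have := psi_mono.measurable
  fun_prop

lemma integral_psi_exp_sub_one {s : ℂ} (hs : 0 < s.re) :
    ∫ u in Ioi (0 : ℝ), ((ψ (Real.exp u) * Real.exp (-u) - 1 : ℝ) : ℂ) * Complex.exp (-s * u) =
      psiLaplace s := by
  have hs0 : s ≠ 0 := by
    rintro rfl
    simp at hs
  have hs1 : s + 1 ≠ 0 := by
    intro h
    have := congrArg Complex.re h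
    simp only [Complex.add_re, Complex.one_re, Complex.zero_re] at this
    linarith
  have hre : (-s).re < 0 := by simpa using hs
  have hi : IntegrableOn (fun u : ℝ => Complex.exp (-s * u)) (Ioi 0) :=
    integrableOn_exp_mul_complex_Ioi hre 0
  have hi' : IntegrableOn (fun u : ℝ => ((ψ (Real.exp u) * Real.exp (-u) : ℝ) : ℂ) *
      Complex.exp (-s * u)) (Ioi 0) := by
    refine Integrable.bdd_mul (c := Real.log 4 + 4) hi ?_ (ae_of_all _ fun u => ?_)
    · exact (Complex.measurable_ofReal.comp measurable_psi_exp_mul_exp_neg).aestronglyMeasurable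
    · rw [Complex.norm_real,
        Real.norm_of_nonneg (mul_nonneg (psi_nonneg _) (Real.exp_nonneg _))]
      exact psi_exp_mul_exp_neg_le u
  have h1 : ∫ u in Ioi (0 : ℝ), ((ψ (Real.exp u) * Real.exp (-u) : ℝ) : ℂ) *
      Complex.exp (-s * u) = LSeries (fun n => (Λ n : ℂ)) (s + 1) / (s + 1) := by
    rw [LSeries_vonMangoldt_eq_integral hs, mul_div_cancel_left₀ _ hs1]
  have h2 := integral_exp_mul_complex_Ioi hre 0
  have h3 : ∀ u : ℝ, ((ψ (Real.exp u) * Real.exp (-u) - 1 : ℝ) : ℂ) * Complex.exp (-s * u) =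
      ((ψ (Real.exp u) * Real.exp (-u) : ℝ) : ℂ) * Complex.exp (-s * u) -
        Complex.exp (-s * u) := by
    intro u
    push_cast
    ring
  simp_rw [h3]
  rw [integral_sub hi' hi, h1, h2, LSeries_vonMangoldt_eq_aux hs, psiLaplace]
  simp only [Complex.ofReal_zero, mul_zero, Complex.exp_zero]
  field_simp
  ring

/-- The prime number theorem for the Chebyshev function `ψ`. -/
theorem tendsto_psi_div_self : Tendsto (fun x => ψ x / x) atTop (𝓝 1) := by
  have h : Tendsto (fun u => ψ (Real.exp u) * Real.exp (-u)) atTop (𝓝 1) := by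
    refine tendsto_one_of_laplace_extends measurable_psi_exp_mul_exp_neg
      (fun u => mul_nonneg (psi_nonneg _) (Real.exp_nonneg _)) psi_exp_mul_exp_neg_le
      (fun u w huw => ?_) (fun s hs => integral_psi_exp_sub_one hs) continuousOn_psiLaplace
    rw [mul_assoc, mul_assoc, ← Real.exp_add, ← Real.exp_add]
    simpa using psi_mono (Real.exp_le_exp.2 huw)
  refine (h.comp Real.tendsto_log_atTop).congr' ?_
  filter_upwards [eventually_gt_atTop 0] with x hx
  simp [Real.exp_neg, Real.exp_log hx, div_eq_mul_inv]

/-- The prime number theorem. -/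
theorem tendsto_primeCounting_mul_log_div_self :
    Tendsto (fun x : ℝ => Nat.primeCounting ⌊x⌋₊ * Real.log x / x) atTop (𝓝 1) := by
  have h1 : Tendsto (fun x : ℝ => (ψ x - θ x) / x) atTop (𝓝 0) := by
    refine (isBigO_psi_sub_theta_sqrt.trans_isLittleO ?_).tendsto_div_nhds_zero
    refine (Asymptotics.isLittleO_iff_tendsto' ?_).2 ?_
    · filter_upwards [eventually_gt_atTop 0] with x hx h
      exact absurd h hx.ne'
    · refine (tendsto_inv_atTop_zero.comp Real.tendsto_sqrt_atTop).congr fun x => ?_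
      simp [Real.sqrt_div_self']
  have h2 : Tendsto (fun x : ℝ => (Nat.primeCounting ⌊x⌋₊ - θ x / Real.log x) *
      (Real.log x / x)) atTop (𝓝 0) := by
    have hO := primeCounting_sub_theta_div_log_isBigO.mul
      (Asymptotics.isBigO_refl (fun x : ℝ => Real.log x / x) atTop)
    refine hO.trans_tendsto ?_
    refine (tendsto_inv_atTop_zero.comp Real.tendsto_log_atTop).congr' ?_
    filter_upwards [eventually_gt_atTop 1] with x hx
    have := Real.log_pos hx
    simp only [Function.comp]
    field_simp
  have h3 := (tendsto_psi_div_self.sub h1).add h2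
  rw [sub_zero, add_zero] at h3
  refine h3.congr' ?_
  filter_upwards [eventually_gt_atTop 1] with x hx
  have := Real.log_pos hx
  field_simp
  ring

end PrimeNumberTheorem

section SmoothCount

open Finset in
lemma card_divisors_prod_prime_pow (P : Finset ℕ) (hP : ∀ p ∈ P, p.Prime) (m : ℕ → ℕ) :
    #(∏ p ∈ P, p ^ m p).divisors = ∏ p ∈ P, (m p + 1) := by
  induction P using Finset.induction_on with
  | empty => simp
  | insert q s hq ih =>
    have hqp := hP q (mem_insert_self q s)
    have hs : ∀ p ∈ s, p.Prime := fun p hp => hP p (mem_insert_of_mem hp)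
    have hcop : (q ^ m q).Coprime (∏ p ∈ s, p ^ m p) := by
      refine Nat.Coprime.prod_right fun p hp => Nat.Coprime.pow _ _ ?_
      exact (Nat.coprime_primes hqp (hs p hp)).2 fun h => hq (h ▸ hp)
    rw [prod_insert hq, prod_insert hq, hcop.card_divisors_mul, ih hs,
      Nat.divisors_prime_pow hqp, card_map, card_range]

lemma finite_smooth (X y : ℝ) :
    {n : ℕ | 1 ≤ n ∧ (n : ℝ) ≤ X ∧ ∀ p : ℕ, p.Prime → p ∣ n → (p : ℝ) ≤ y}.Finite :=
  (finite_Iic ⌊X⌋₊).subset fun _ hn => Nat.le_floor hn.2.1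

/-- A lower bound for the number of smooth integers, obtained by bounding each exponent
separately. -/
lemma pow_le_smoothCount {X y : ℝ} (hX : 1 < X) (hy : 2 ≤ y) :
    (Real.log X / (Nat.primeCounting ⌊y⌋₊ * Real.log y)) ^ Nat.primeCounting ⌊y⌋₊ ≤
      smoothCount X y := by
  set k := Nat.primeCounting ⌊y⌋₊ with hk
  set P := Nat.primesLE ⌊y⌋₊ with hP
  have hcard : P.card = k := Nat.primesLE_card_eq_primeCounting _
  have hL := Real.log_pos hX
  have hk0 : 0 < k := by
    rw [← hcard, Finset.card_pos]
    exact ⟨2, Nat.mem_primesLE.2 ⟨Nat.le_floor (by exact_mod_cast hy), Nat.prime_two⟩⟩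
  have hk0' : (0 : ℝ) < k := by exact_mod_cast hk0
  have hprime : ∀ p ∈ P, p.Prime := fun p hp => Nat.prime_of_mem_primesLE hp
  have hle : ∀ p ∈ P, (p : ℝ) ≤ y := fun p hp =>
    (Nat.le_floor_iff (by linarith)).1 (Nat.le_of_mem_primesLE hp)
  have hlog : ∀ p ∈ P, 0 < Real.log p := fun p hp =>
    Real.log_pos (by exact_mod_cast (hprime p hp).one_lt)
  let m : ℕ → ℕ := fun p => ⌊Real.log X / (k * Real.log p)⌋₊
  let T : ℕ := ∏ p ∈ P, p ^ m p
  have hT0 : 0 < T := Finset.prod_pos fun p hp => pow_pos (hprime p hp).pos _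
  have hTX : (T : ℝ) ≤ X := by
    have hT0' : (0 : ℝ) < T := by exact_mod_cast hT0
    rw [← Real.log_le_log_iff hT0' (by linarith)]
    have h1 : Real.log T = ∑ p ∈ P, m p * Real.log p := by
      simp only [T]
      push_cast
      rw [Real.log_prod fun p hp => by
        have := (hprime p hp).pos
        positivity]
      simp
    rw [h1]
    calc ∑ p ∈ P, m p * Real.log p ≤ ∑ p ∈ P, Real.log X / k := by
          refine Finset.sum_le_sum fun p hp => ?_
          have h2 := hlog p hp
          calc (m p : ℝ) * Real.log p ≤ Real.log X / (k * Real.log p) * Real.log p := by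
                gcongr
                exact Nat.floor_le (by positivity)
            _ = Real.log X / k := by field_simp
      _ = Real.log X := by
          rw [Finset.sum_const, hcard, nsmul_eq_mul]
          field_simp
  have hsub : (T.divisors : Set ℕ) ⊆
      {n : ℕ | 1 ≤ n ∧ (n : ℝ) ≤ X ∧ ∀ p : ℕ, p.Prime → p ∣ n → (p : ℝ) ≤ y} := by
    intro d hd
    have hd' := Nat.dvd_of_mem_divisors (Finset.mem_coe.1 hd)
    refine ⟨Nat.pos_of_mem_divisors (Finset.mem_coe.1 hd), ?_, fun q hq hqd => ?_⟩
    · exact le_trans (by exact_mod_cast Nat.le_of_dvd hT0 hd') hTX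
    · obtain ⟨p, hp, hqp⟩ := (hq.prime.dvd_finsetProd_iff _).1 (hqd.trans hd')
      rw [(Nat.prime_dvd_prime_iff_eq hq (hprime p hp)).1 (hq.dvd_of_dvd_pow hqp)]
      exact hle p hp
  have hcount : ∏ p ∈ P, (m p + 1) ≤ smoothCount X y := by
    rw [← card_divisors_prod_prime_pow P hprime m, ← Set.ncard_coe_finset]
    exact Set.ncard_le_ncard hsub (finite_smooth X y)
  refine le_trans ?_ (Nat.cast_le.2 hcount)
  rw [← hcard, ← Finset.prod_const]
  push_cast
  refine Finset.prod_le_prod (fun p _ => ?_) fun p hp => ?_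
  · have := Real.log_pos (show 1 < y by linarith)
    positivity
  · have h2 := hlog p hp
    have h3 : Real.log p ≤ Real.log y :=
      Real.log_le_log (by exact_mod_cast (hprime p hp).pos) (hle p hp)
    rw [hcard]
    calc Real.log X / (k * Real.log y) ≤ Real.log X / (k * Real.log p) := by gcongr
      _ ≤ m p + 1 := (Nat.lt_floor_add_one _).le

/-- Rankin's upper bound for the number of smooth integers. -/
lemma smoothCount_le_rankin {X y σ : ℝ} (hX : 0 < X) (hσ : 0 < σ) :
    (smoothCount X y : ℝ) ≤
      X ^ σ * ∏ p ∈ Nat.primesLE ⌊y⌋₊, (1 - (p : ℝ) ^ (-σ))⁻¹ := by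
  let f : ℕ →* ℝ :=
    { toFun := fun n => (n : ℝ) ^ (-σ)
      map_one' := by simp
      map_mul' := fun a b => by
        push_cast
        exact Real.mul_rpow (Nat.cast_nonneg a) (Nat.cast_nonneg b) }
  have hf : ∀ n, f n = (n : ℝ) ^ (-σ) := fun _ => rfl
  have hf0 : ∀ n, 0 ≤ f n := fun n => Real.rpow_nonneg (Nat.cast_nonneg n) _
  have hsum := (EulerProduct.summable_and_hasSum_smoothNumbers_prod_primesBelow_geometric
    (f := f) (fun {p} hp => by
      rw [Real.norm_of_nonneg (hf0 p), hf]
      exact Real.rpow_lt_one_of_one_lt_of_neg (by exact_mod_cast hp.one_lt) (by linarith))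
    (⌊y⌋₊ + 1)).2
  replace hsum := (hasSum_subtype_iff_indicator (f := fun n : ℕ => f n)).1 hsum
  have hfin := finite_smooth X y
  have h1 : ∑ n ∈ hfin.toFinset, f n ≤ ∏ p ∈ Nat.primesLE ⌊y⌋₊, (1 - (p : ℝ) ^ (-σ))⁻¹ := by
    refine le_trans (Finset.sum_le_sum fun n hn => ?_)
      (sum_le_hasSum hfin.toFinset (fun n _ => indicator_nonneg (fun n _ => hf0 n) n) hsum)
    rw [indicator_of_mem]
    have hn' := hfin.mem_toFinset.1 hn
    refine ⟨by have := hn'.1; omega, fun p hp => Nat.lt_succ_of_le (Nat.le_floor ?_)⟩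
    exact hn'.2.2 p (Nat.prime_of_mem_primeFactorsList hp) (Nat.dvd_of_mem_primeFactorsList hp)
  have h2 : (smoothCount X y : ℝ) = ∑ n ∈ hfin.toFinset, (1 : ℝ) := by
    rw [smoothCount, Set.ncard_eq_toFinset_card _ hfin]
    simp
  rw [h2]
  refine le_trans ?_ (mul_le_mul_of_nonneg_left h1 (Real.rpow_nonneg hX.le σ))
  rw [Finset.mul_sum]
  refine Finset.sum_le_sum fun n hn => ?_
  have hn' := hfin.mem_toFinset.1 hn
  have hn0 : (0 : ℝ) < n := by exact_mod_cast hn'.1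
  rw [hf, Real.rpow_neg hn0.le, ← div_eq_mul_inv, one_le_div (Real.rpow_pos_of_pos hn0 σ)]
  exact Real.rpow_le_rpow hn0.le hn'.2.1 hσ.le

lemma inv_one_sub_exp_neg_le {t : ℝ} (ht : 0 < t) : (1 - Real.exp (-t))⁻¹ ≤ 1 + 1 / t := by
  have h1 := Real.add_one_le_exp t
  have h2 : Real.exp (-t) * Real.exp t = 1 := by rw [← Real.exp_add]; simp
  have h3 := Real.exp_pos (-t)
  have h4 : Real.exp (-t) < 1 := Real.exp_lt_one_iff.2 (by linarith)
  rw [inv_le_iff_one_le_mul₀ (by linarith)]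
  have : (1 + 1 / t) * (1 - Real.exp (-t)) - 1 = (1 - Real.exp (-t) * (t + 1)) / t := by
    field_simp
    ring
  have h5 : 0 ≤ (1 - Real.exp (-t) * (t + 1)) / t := div_nonneg (by nlinarith) ht.le
  linarith

lemma one_le_smoothCount {X : ℝ} (hX : 1 ≤ X) (y : ℝ) : 1 ≤ smoothCount X y := by
  refine (Set.ncard_pos (finite_smooth X y)).2 ⟨1, le_rfl, by simpa using hX, fun p hp h => ?_⟩
  exact absurd (Nat.dvd_one.1 h) hp.one_lt.ne'

lemma card_primesLE_filter_lt_le (n : ℕ) {z : ℝ} (hz : 0 ≤ z) :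
    (((Nat.primesLE n).filter fun p : ℕ => (p : ℝ) < z).card : ℝ) ≤ z := by
  have hsub : ((Nat.primesLE n).filter fun p : ℕ => (p : ℝ) < z) ⊆ Finset.Icc 1 ⌊z⌋₊ := by
    intro p hp
    rw [Finset.mem_filter] at hp
    exact Finset.mem_Icc.2 ⟨(Nat.prime_of_mem_primesLE hp.1).one_le, Nat.le_floor hp.2.le⟩
  calc _ ≤ ((Finset.Icc 1 ⌊z⌋₊).card : ℝ) := by exact_mod_cast Finset.card_le_card hsub
    _ ≤ z := by simpa using Nat.floor_le hz

lemma log_smoothCount_le {X y : ℝ} (hX : 1 < X) (hy : 2 ≤ y) (hR : 1 ≤ Real.log X / y) :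
    Real.log (smoothCount X y) ≤ y / Real.log y +
      Nat.primeCounting ⌊y⌋₊ * (Real.log 3 + Real.log (Real.log X / y)) +
        √y * Real.log y := by
  have hL := Real.log_pos hX
  have hly := Real.log_pos (show 1 < y by linarith)
  set R := Real.log X / y with hRdef
  set P := Nat.primesLE ⌊y⌋₊ with hP
  set σ := y / (Real.log X * Real.log y) with hσdef
  have hσ : 0 < σ := by positivity
  have hprime : ∀ p ∈ P, p.Prime := fun p hp => Nat.prime_of_mem_primesLE hp
  have hlog : ∀ p ∈ P, 0 < Real.log p := fun p hp =>
    Real.log_pos (by exact_mod_cast (hprime p hp).one_lt)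
  have hfac : ∀ p ∈ P, 0 < (1 - (p : ℝ) ^ (-σ))⁻¹ := fun p hp => by
    have := Real.rpow_lt_one_of_one_lt_of_neg (x := p) (z := -σ)
      (by exact_mod_cast (hprime p hp).one_lt) (by linarith)
    exact inv_pos.2 (by linarith)
  have hterm : ∀ p ∈ P, Real.log (1 - (p : ℝ) ^ (-σ))⁻¹ ≤
      (Real.log 3 + Real.log R) + if (p : ℝ) < √y then Real.log y else 0 := by
    intro p hp
    have hp0 : (0 : ℝ) < p := by exact_mod_cast (hprime p hp).pos
    have hlp := hlog p hp
    have h1 : (1 - (p : ℝ) ^ (-σ))⁻¹ ≤ 1 + R * (Real.log y / Real.log p) := by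
      have h := inv_one_sub_exp_neg_le (mul_pos hσ hlp)
      have h2 : (p : ℝ) ^ (-σ) = Real.exp (-(σ * Real.log p)) := by
        rw [Real.rpow_def_of_pos hp0]
        ring_nf
      have h3 : 1 / (σ * Real.log p) = R * (Real.log y / Real.log p) := by
        rw [hσdef, hRdef]
        field_simp
      rw [h2, ← h3]
      exact h
    refine (Real.log_le_log (hfac p hp) h1).trans ?_
    rw [← Real.log_mul (by norm_num) (by positivity)]
    split_ifs with hps
    · have h2 : Real.log y / Real.log p ≤ 2 * Real.log y := by
        have h3 : Real.log 2 ≤ Real.log p :=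
          Real.log_le_log two_pos (by exact_mod_cast (hprime p hp).two_le)
        have h4 := Real.log_two_gt_d9
        rw [div_le_iff₀ hlp]
        nlinarith
      have h3 : 1 + R * (Real.log y / Real.log p) ≤ 3 * R * (1 + Real.log y) := by
        have := mul_le_mul_of_nonneg_left h2 (by linarith : 0 ≤ R)
        nlinarith
      refine (Real.log_le_log (by positivity) h3).trans ?_
      rw [Real.log_mul (by positivity) (by positivity)]
      have := Real.log_le_sub_one_of_pos (show 0 < 1 + Real.log y by linarith)
      linarith
    · rw [add_zero]
      refine Real.log_le_log (by positivity) ?_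
      have h2 : Real.log y / Real.log p ≤ 2 := by
        have h3 : Real.log √y ≤ Real.log p :=
          Real.log_le_log (Real.sqrt_pos.2 (by linarith)) (not_lt.1 hps)
        rw [Real.log_sqrt (by linarith)] at h3
        rw [div_le_iff₀ hlp]
        linarith
      nlinarith
  have hpos : (0 : ℝ) < smoothCount X y := by exact_mod_cast one_le_smoothCount hX.le y
  have hX0 : 0 < X := by linarith
  have hmain := Real.log_le_log hpos (smoothCount_le_rankin hX0 hσ)
  rw [Real.log_mul (Real.rpow_pos_of_pos hX0 σ).ne' (Finset.prod_pos hfac).ne',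
    Real.log_rpow hX0, Real.log_prod fun p hp => (hfac p hp).ne'] at hmain
  have hσL : σ * Real.log X = y / Real.log y := by
    rw [hσdef]
    field_simp
  have hsum := Finset.sum_le_sum hterm
  rw [Finset.sum_add_distrib, Finset.sum_const, Nat.primesLE_card_eq_primeCounting, nsmul_eq_mul,
    ← Finset.sum_filter, Finset.sum_const, nsmul_eq_mul] at hsum
  have hsmall := mul_le_mul_of_nonneg_right
    (card_primesLE_filter_lt_le ⌊y⌋₊ (Real.sqrt_nonneg y)) hly.le
  rw [hσL] at hmain
  linarith

lemma le_log_smoothCount {X y : ℝ} (hX : 1 < X) (hy : 2 ≤ y)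
    (hk : 0 < Nat.primeCounting ⌊y⌋₊) :
    Nat.primeCounting ⌊y⌋₊ * (Real.log (Real.log X / y) -
      Real.log (Nat.primeCounting ⌊y⌋₊ * Real.log y / y)) ≤ Real.log (smoothCount X y) := by
  have hL := Real.log_pos hX
  have hly := Real.log_pos (show 1 < y by linarith)
  have hk' : (0 : ℝ) < Nat.primeCounting ⌊y⌋₊ := by exact_mod_cast hk
  have h := Real.log_le_log (by positivity) (pow_le_smoothCount hX hy)
  rw [Real.log_pow] at h
  rw [← Real.log_div (by positivity) (by positivity)]
  convert h using 3
  field_simp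

end SmoothCount

open Filter in
theorem log_smoothCount_asymptotic (y : ℝ → ℝ)
    (hy_tendsto : Tendsto y atTop atTop)
    (hy_small : Tendsto (fun X => y X / Real.log X) atTop (nhds 0)) :
    Tendsto
      (fun X => Real.log (smoothCount X (y X)) /
        ((y X / Real.log (y X)) * Real.log (Real.log X / y X)))
      atTop (nhds 1) := by
  have hk := tendsto_primeCounting_mul_log_div_self.comp hy_tendsto
  have hX : ∀ᶠ X : ℝ in atTop, 1 < X := eventually_gt_atTop 1
  have hy2 := hy_tendsto.eventually_ge_atTop 2
  have hR : Tendsto (fun X => Real.log X / y X) atTop atTop := by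
    have h : Tendsto (fun X => y X / Real.log X) atTop (𝓝[>] 0) := by
      refine tendsto_nhdsWithin_iff.2 ⟨hy_small, ?_⟩
      filter_upwards [hX, hy2] with X h1 h2
      exact div_pos (by linarith) (Real.log_pos h1)
    refine h.inv_tendsto_nhdsGT_zero.congr fun X => ?_
    simp
  have hlogR := Real.tendsto_log_atTop.comp hR
  have hinv := tendsto_inv_atTop_zero.comp hlogR
  have hsq : Tendsto (fun X => Real.log (y X) ^ 2 / √(y X)) atTop (𝓝 0) := by
    have h := (isLittleO_log_rpow_rpow_atTop (s := 1 / 2) 2 (by norm_num)).tendsto_div_nhds_zero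
    refine (h.comp hy_tendsto).congr fun X => ?_
    simp [Real.sqrt_eq_rpow]
  have hlower : Tendsto (fun X => Nat.primeCounting ⌊y X⌋₊ * Real.log (y X) / y X *
      (1 - Real.log (Nat.primeCounting ⌊y X⌋₊ * Real.log (y X) / y X) *
        (Real.log (Real.log X / y X))⁻¹)) atTop (𝓝 1) := by
    have h := hk.mul ((hk.log one_ne_zero).mul hinv |>.const_sub 1)
    simpa [Function.comp_def] using h
  have hupper : Tendsto (fun X => (Real.log (Real.log X / y X))⁻¹ +
      Nat.primeCounting ⌊y X⌋₊ * Real.log (y X) / y X *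
        (1 + Real.log 3 * (Real.log (Real.log X / y X))⁻¹) +
      Real.log (y X) ^ 2 / √(y X) * (Real.log (Real.log X / y X))⁻¹) atTop (𝓝 1) := by
    have h := (hinv.add (hk.mul ((hinv.const_mul (Real.log 3)).const_add 1))).add (hsq.mul hinv)
    simpa [Function.comp_def] using h
  refine tendsto_of_tendsto_of_tendsto_of_le_of_le' hlower hupper ?_ ?_
  · filter_upwards [hX, hy2, hlogR.eventually_gt_atTop 0, hk.eventually_const_lt one_half_lt_one]
      with X h1 h2 h3 h4
    have h3' : 0 < Real.log (Real.log X / y X) := h3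
    have hly := Real.log_pos (show 1 < y X by linarith)
    have hk0 : 0 < Nat.primeCounting ⌊y X⌋₊ := by
      rcases Nat.eq_zero_or_pos (Nat.primeCounting ⌊y X⌋₊) with h | h
      · simp only [Function.comp, h] at h4
        norm_num at h4
      · exact h
    have h0 : 0 < y X := by linarith
    rw [le_div_iff₀ (by positivity)]
    refine le_trans (le_of_eq ?_) (le_log_smoothCount h1 h2 hk0)
    field_simp
  · filter_upwards [hX, hy2, hlogR.eventually_gt_atTop 0, hR.eventually_ge_atTop 1]
      with X h1 h2 h3 h4
    have h3' : 0 < Real.log (Real.log X / y X) := h3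
    have hly := Real.log_pos (show 1 < y X by linarith)
    have h0 : 0 < y X := by linarith
    rw [div_le_iff₀ (by positivity)]
    refine (log_smoothCount_le h1 h2 h4).trans (le_of_eq ?_)
    have hs : √(y X) ≠ 0 := (Real.sqrt_pos.2 h0).ne'
    have hs3 : Real.log (y X) ^ 2 / √(y X) * (Real.log (Real.log X / y X))⁻¹ *
        (y X / Real.log (y X) * Real.log (Real.log X / y X)) = √(y X) * Real.log (y X) := by
      have hs4 : y X / √(y X) = √(y X) := Real.div_sqrt
      calc _ = y X / √(y X) * Real.log (y X) := by field_simp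
        _ = _ := by rw [hs4]
    rw [add_mul, hs3]
    field_simp
    ring
end
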